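/- There exist constants c₁, c₂ > 0, depending only on the structural parameters N₀, c₀, β, such that for every ring R ⊆ ℝ²: c₁ · d(R)² ≤ |R| ≤ c₂ · d(R)², where |R| is the Lebesgue measure of R and d(R) is its diameter. -/

import Mathlib

open scoped Classical

open Set Metric MeasureTheory ENNReal

noncomputable section

/-- The Euclidean plane `ℝ²`. -/
abbrev Plane : Type := EuclideanSpace ℝ (Fin 2)

/-- `Q` is a compact regular convex set whose boundary is a polygon consisting of at most
`N₀` line segments, with eccentricity bounded by `c₀`. -/
def IsRegularConvexPolygon (N₀ : ℕ) (c₀ : ℝ) (Q : Set Plane) : Prop :=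
  IsCompact Q ∧ Convex ℝ Q ∧ Q.Nonempty ∧
    (∃ (m : ℕ) (v w : Fin m → Plane), m ≤ N₀ ∧ frontier Q = ⋃ i, segment ℝ (v i) (w i)) ∧
    (∃ (x₁ x₂ : Plane) (r₁ r₂ : ℝ), 0 < r₂ ∧
      closedBall x₂ r₂ ⊆ Q ∧ Q ⊆ closedBall x₁ r₁ ∧ r₁ ≤ c₀ * r₂)

/-- There is a triangle contained in `R` having the segment `[a,b]` as a side, whose two
angles adjacent to that side are equal to `β`. -/
def HasGoodTriangle (β : ℝ) (R : Set Plane) (a b : Plane) : Prop :=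
  ∃ c : Plane, convexHull ℝ {a, b, c} ⊆ R ∧
    EuclideanGeometry.angle b a c = β ∧ EuclideanGeometry.angle a b c = β

/-- `R ⊆ ℝ²` is a ring with structural parameters `N₀`, `c₀`, `β`: the difference of two
regular compact convex sets with polygonal boundaries, admitting no uncontrollably narrow
elongated subregions (each maximal edge of the boundary can be subdivided into at most two
segments, each carrying a good triangle with adjacent angles `β` inside `R`). -/
def IsRing (N₀ : ℕ) (c₀ β : ℝ) (R : Set Plane) : Prop :=
  (∃ Q₁ Q₂ : Set Plane,
      IsRegularConvexPolygon N₀ c₀ Q₁ ∧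
      (Q₂ = ∅ ∨ (Q₂ ⊆ Q₁ ∧ IsRegularConvexPolygon N₀ c₀ Q₂)) ∧
      R = Q₁ \ interior Q₂) ∧
  (∃ (m : ℕ) (v w : Fin m → Plane),
      frontier R = ⋃ i, segment ℝ (v i) (w i) ∧
      (∀ i, ∀ a b : Plane, segment ℝ (v i) (w i) ⊆ segment ℝ a b →
        segment ℝ a b ⊆ frontier R → segment ℝ a b = segment ℝ (v i) (w i)) ∧
      (∀ i, ∃ p ∈ segment ℝ (v i) (w i),
        HasGoodTriangle β R (v i) p ∧ HasGoodTriangle β R p (w i)))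

/-- `Ω` is the union of `n` rings with pairwise disjoint interiors. -/
def IsRingDecomp (N₀ : ℕ) (c₀ β : ℝ) (n : ℕ) (Ω : Set Plane) : Prop :=
  ∃ R : Fin n → Set Plane,
    (∀ j, IsRing N₀ c₀ β (R j)) ∧
    (∀ i j, i ≠ j → interior (R i) ∩ interior (R j) = ∅) ∧
    (⋃ j, R j) = Ω

/-- Membership in the nonlinear spline class `S(n,k)`: piecewise polynomials of total degree
`< k` over `n` rings with pairwise disjoint interiors whose union is `Ω` (or, when `Ω = ℝ²`,
whose union -- the support of the spline -- is itself a ring), having maximum smoothness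
`W^{k-2}(Ω)` when `k ≥ 2` (no smoothness is required for piecewise constants, `k = 1`). -/
def IsSpline (N₀ : ℕ) (c₀ β : ℝ) (n k : ℕ) (Ω : Set Plane) (S : Plane → ℝ) : Prop :=
  ∃ (R : Fin n → Set Plane) (P : Fin n → MvPolynomial (Fin 2) ℝ),
    (∀ j, IsRing N₀ c₀ β (R j)) ∧
    (∀ i j, i ≠ j → interior (R i) ∩ interior (R j) = ∅) ∧
    ((⋃ j, R j) = Ω ∨ (Ω = Set.univ ∧ IsRing N₀ c₀ β (⋃ j, R j))) ∧
    (∀ j, (P j).totalDegree < k) ∧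
    (S = fun x => ∑ j, (R j).indicator (fun y => MvPolynomial.eval (fun i => y i) (P j)) x) ∧
    (2 ≤ k → ContDiffOn ℝ ((k - 2 : ℕ) : ℕ∞) S Ω)

/-- The spline class `S(n,k,r)` with defect: smoothness `W^r(Ω)` instead of the maximal
smoothness `W^{k-2}(Ω)`. -/
def IsSplineDefect (N₀ : ℕ) (c₀ β : ℝ) (n k r : ℕ) (Ω : Set Plane) (S : Plane → ℝ) : Prop :=
  ∃ (R : Fin n → Set Plane) (P : Fin n → MvPolynomial (Fin 2) ℝ),
    (∀ j, IsRing N₀ c₀ β (R j)) ∧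
    (∀ i j, i ≠ j → interior (R i) ∩ interior (R j) = ∅) ∧
    ((⋃ j, R j) = Ω ∨ (Ω = Set.univ ∧ IsRing N₀ c₀ β (⋃ j, R j))) ∧
    (∀ j, (P j).totalDegree < k) ∧
    (S = fun x => ∑ j, (R j).indicator (fun y => MvPolynomial.eval (fun i => y i) (P j)) x) ∧
    ContDiffOn ℝ ((r : ℕ) : ℕ∞) S Ω

/-- The `L^p(Ω)` quasi-norm, `0 < p < ∞`. -/
def lpNormE (p : ℝ) (Ω : Set Plane) (f : Plane → ℝ) : ℝ≥0∞ :=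
  eLpNorm f (ENNReal.ofReal p) (volume.restrict Ω)

/-- `k`-th finite difference `Δ_h^k f(x)`, set to `0` unless the segment `[x, x+kh] ⊆ Ω`. -/
def deltah (Ω : Set Plane) (k : ℕ) (h : Plane) (f : Plane → ℝ) (x : Plane) : ℝ :=
  if segment ℝ x (x + (k : ℝ) • h) ⊆ Ω then
    ∑ ν ∈ Finset.range (k + 1), (-1 : ℝ) ^ (k + ν) * (k.choose ν : ℝ) * f (x + (ν : ℝ) • h)
  else 0

/-- Modulus of smoothness `ω_k(f,t)_τ = sup_{|h| ≤ t} ‖Δ_h^k f‖_{L^τ(Ω)}`. -/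
def modulus (Ω : Set Plane) (k : ℕ) (τ : ℝ) (f : Plane → ℝ) (t : ℝ) : ℝ≥0∞ :=
  ⨆ (h : Plane) (_ : ‖h‖ ≤ t), lpNormE τ Ω (deltah Ω k h f)

/-- Besov seminorm `|f|_{B^{s,k}_τ} = (∫₀^∞ [t^{-s} ω_k(f,t)_τ]^τ dt/t)^{1/τ}`. -/
def besovSeminorm (Ω : Set Plane) (k : ℕ) (s τ : ℝ) (f : Plane → ℝ) : ℝ≥0∞ :=
  (∫⁻ t in Set.Ioi (0 : ℝ),
      (ENNReal.ofReal (t ^ (-s)) * modulus Ω k τ f t) ^ τ / ENNReal.ofReal t) ^ (1 / τ)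

/-- Error of best `L^p(Ω)`-approximation `S_n^k(f)_p` from the spline class `S(n,k)`. -/
def splineApprox (N₀ : ℕ) (c₀ β : ℝ) (n k : ℕ) (p : ℝ) (Ω : Set Plane) (f : Plane → ℝ) :
    ℝ≥0∞ :=
  ⨅ (S : Plane → ℝ) (_ : IsSpline N₀ c₀ β n k Ω S), lpNormE p Ω fun x => f x - S x

/-- The K-functional `K(f,t; L^p(Ω), B^{s,k}_τ)`. -/
def kFunctional (Ω : Set Plane) (k : ℕ) (s τ p : ℝ) (f : Plane → ℝ) (t : ℝ) : ℝ≥0∞ :=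
  ⨅ g : Plane → ℝ,
    lpNormE p Ω (fun x => f x - g x) + ENNReal.ofReal t * besovSeminorm Ω k s τ g

/-- BV seminorm: the total mass of the distributional gradient of `g` on `Ω`, defined by
duality against compactly supported `C¹` vector fields of norm at most one. -/
def bvSeminorm (Ω : Set Plane) (g : Plane → ℝ) : ℝ≥0∞ :=
  ⨆ (φ : Plane → Plane) (_ : ContDiff ℝ 1 φ ∧ HasCompactSupport φ ∧
      tsupport φ ⊆ interior Ω ∧ ∀ x, ‖φ x‖ ≤ 1),
    ENNReal.ofReal (∫ x in Ω, g x * ∑ i, fderiv ℝ φ x (EuclideanSpace.single i 1) i)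

/-- The K-functional `K(f,t; L²(Ω), BV(Ω))`. -/
def kFunctionalBV (Ω : Set Plane) (f : Plane → ℝ) (t : ℝ) : ℝ≥0∞ :=
  ⨅ g : Plane → ℝ,
    lpNormE 2 Ω (fun x => f x - g x) + ENNReal.ofReal t * bvSeminorm Ω g

/-- The signed area of the parallelogram spanned by two plane vectors. -/
def planeCross (u v : Plane) : ℝ := u 0 * v 1 - u 1 * v 0

theorem planeCross_sq (u v : Plane) :
    planeCross u v ^ 2 = (‖u‖ * ‖v‖ * Real.sin (InnerProductGeometry.angle u v)) ^ 2 := by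
  have h := InnerProductGeometry.cos_angle_mul_norm_mul_norm u v
  have hu : ‖u‖ ^ 2 = u 0 ^ 2 + u 1 ^ 2 := by simp [EuclideanSpace.real_norm_sq_eq]
  have hv : ‖v‖ ^ 2 = v 0 ^ 2 + v 1 ^ 2 := by simp [EuclideanSpace.real_norm_sq_eq]
  have hin : inner ℝ u v = u 0 * v 0 + u 1 * v 1 := by
    simp [PiLp.inner_apply, mul_comm]
  have hs := Real.sin_sq (InnerProductGeometry.angle u v)
  have : (‖u‖ * ‖v‖ * Real.sin (InnerProductGeometry.angle u v)) ^ 2 =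
      ‖u‖ ^ 2 * ‖v‖ ^ 2 -
        (Real.cos (InnerProductGeometry.angle u v) * (‖u‖ * ‖v‖)) ^ 2 := by
    rw [mul_pow, hs]; ring
  rw [this, h, hin, hu, hv, planeCross]
  ring

theorem abs_planeCross (u v : Plane) :
    |planeCross u v| = ‖u‖ * ‖v‖ * Real.sin (InnerProductGeometry.angle u v) := by
  have h : 0 ≤ ‖u‖ * ‖v‖ * Real.sin (InnerProductGeometry.angle u v) :=
    mul_nonneg (by positivity) (InnerProductGeometry.sin_angle_nonneg u v)
  rw [← abs_of_nonneg h]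
  exact (sq_eq_sq_iff_abs_eq_abs _ _).1 (planeCross_sq u v)

/-- A triangle whose two angles at the side `[a, b]` are equal to `β` spans a large
parallelogram. -/
theorem sin_mul_dist_sq_le_abs_planeCross {β : ℝ} {a b c : Plane}
    (ha : EuclideanGeometry.angle b a c = β) (hb : EuclideanGeometry.angle a b c = β) :
    Real.sin β / 2 * dist a b ^ 2 ≤ |planeCross (b - a) (c - a)| := by
  have hA : |planeCross (b - a) (c - a)| = dist a b * dist a c * Real.sin β := by
    rw [abs_planeCross, ← ha, dist_comm a b, dist_comm a c, dist_eq_norm, dist_eq_norm]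
    rfl
  have hB : |planeCross (b - a) (c - a)| = dist a b * dist c b * Real.sin β := by
    have : planeCross (b - a) (c - a) = -planeCross (a - b) (c - b) := by
      simp only [planeCross, PiLp.sub_apply]; ring
    rw [this, abs_neg, abs_planeCross, ← hb, dist_eq_norm, dist_eq_norm]
    rfl
  have hs : 0 ≤ Real.sin β := by
    rw [← ha]; exact InnerProductGeometry.sin_angle_nonneg _ _
  have h := mul_le_mul_of_nonneg_left (dist_triangle a c b)
    (mul_nonneg hs (dist_nonneg (x := a) (y := b)))
  nlinarith

theorem volume_convexHull_triple_ge (a b c : Plane) :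
    ENNReal.ofReal (|planeCross (b - a) (c - a)| / 4) ≤ volume (convexHull ℝ {a, b, c}) := by
  set u := b - a with hu
  set v := c - a with hv
  set T : Plane →ₗ[ℝ] Plane := Matrix.toLpLin 2 2 !![u 0, v 0; u 1, v 1] with hT
  have hTx : ∀ x : Plane, T x = x 0 • u + x 1 • v := by
    intro x
    ext i
    fin_cases i <;>
      simp [hT, Matrix.toLpLin_apply, dotProduct, Fin.sum_univ_two, mul_comm]
  have hdet : LinearMap.det T = planeCross u v := by
    rw [hT, LinearMap.det_toLpLin, Matrix.det_fin_two_of, planeCross]; ring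
  set S : Set Plane := (WithLp.ofLp : Plane → Fin 2 → ℝ) ⁻¹'
    Set.pi univ (fun _ => Icc (0 : ℝ) (1 / 2)) with hS
  have hvolS : volume S = ENNReal.ofReal (1 / 4) := by
    rw [hS, (PiLp.volume_preserving_ofLp (Fin 2)).measure_preimage
      (MeasurableSet.univ_pi fun _ => measurableSet_Icc).nullMeasurableSet, volume_pi_pi]
    simp only [Real.volume_Icc, sub_zero, Finset.prod_const, Finset.card_univ, Fintype.card_fin]
    rw [← ENNReal.ofReal_pow (by norm_num)]
    norm_num
  have hsub : (fun x => a + x) '' (T '' S) ⊆ convexHull ℝ {a, b, c} := by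
    rintro _ ⟨_, ⟨x, hx, rfl⟩, rfl⟩
    have h0 : x 0 ∈ Icc (0 : ℝ) (1 / 2) := hx 0 trivial
    have h1 : x 1 ∈ Icc (0 : ℝ) (1 / 2) := hx 1 trivial
    have hmem : (1 - x 0 - x 1) • a + x 0 • b + x 1 • c ∈ convexHull ℝ {a, b, c} := by
      have h := (convex_convexHull ℝ ({a, b, c} : Set Plane)).sum_mem (t := Finset.univ)
        (w := ![1 - x 0 - x 1, x 0, x 1]) (z := ![a, b, c])
        (by intro i _; fin_cases i <;> simp <;> linarith [h0.1, h0.2, h1.1, h1.2])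
        (by simp [Fin.sum_univ_three]; ring)
        (by intro i _; fin_cases i <;> exact subset_convexHull ℝ _ (by simp))
      simpa [Fin.sum_univ_three] using h
    have : a + T x = (1 - x 0 - x 1) • a + x 0 • b + x 1 • c := by
      rw [hTx, hu, hv]; module
    simpa only [this] using hmem
  calc ENNReal.ofReal (|planeCross u v| / 4)
      = ENNReal.ofReal |LinearMap.det T| * volume S := by
        rw [hdet, hvolS, ← ENNReal.ofReal_mul (abs_nonneg _)]; congr 1; ring
    _ = volume ((fun x => a + x) '' (T '' S)) := by
        rw [← Measure.addHaar_image_linearMap volume T S]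
        rw [image_add_left, measure_preimage_add]
    _ ≤ volume (convexHull ℝ {a, b, c}) := measure_mono hsub

theorem HasGoodTriangle.dist_sq_le_volume {β : ℝ} {R : Set Plane} {a b : Plane}
    (h : HasGoodTriangle β R a b) (hR : Bornology.IsBounded R) :
    Real.sin β / 8 * dist a b ^ 2 ≤ (volume R).toReal := by
  obtain ⟨c, hc, ha, hb⟩ := h
  have h1 := sin_mul_dist_sq_le_abs_planeCross ha hb
  have h2 := (volume_convexHull_triple_ge a b c).trans (measure_mono hc)
  have h3 := (ENNReal.ofReal_le_iff_le_toReal hR.measure_lt_top.ne).1 h2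
  linarith

/-- A segment containing two distinct points lies on the line through them. -/
theorem exists_eq_lineMap_of_mem_segment {E : Type*} [AddCommGroup E] [Module ℝ E]
    {p q a b : E} (hpq : p ≠ q) (hp : p ∈ segment ℝ a b) (hq : q ∈ segment ℝ a b) :
    ∃ x y : ℝ, AffineMap.lineMap p q x = a ∧ AffineMap.lineMap p q y = b := by
  rw [segment_eq_image_lineMap] at hp hq
  obtain ⟨s, -, rfl⟩ := hp
  obtain ⟨t, -, rfl⟩ := hq
  have hst : t - s ≠ 0 := fun h => hpq (by rw [sub_eq_zero.1 h])
  refine ⟨-s / (t - s), (1 - s) / (t - s), ?_, ?_⟩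
  all_goals
    rw [AffineMap.lineMap_apply_module' (AffineMap.lineMap a b s),
      show AffineMap.lineMap a b t - AffineMap.lineMap a b s = (t - s) • (b - a) by
        simp only [AffineMap.lineMap_apply_module']; module,
      smul_smul, div_mul_cancel₀ _ hst, AffineMap.lineMap_apply_module']
    module

/-- Two segments sharing two distinct points have a segment as their union. -/
theorem exists_segment_eq_union {E : Type*} [AddCommGroup E] [Module ℝ E]
    {p q a b v w : E} (hpq : p ≠ q)
    (hp : p ∈ segment ℝ a b ∩ segment ℝ v w) (hq : q ∈ segment ℝ a b ∩ segment ℝ v w) :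
    ∃ c d : E, segment ℝ c d = segment ℝ a b ∪ segment ℝ v w := by
  obtain ⟨x, y, rfl, rfl⟩ := exists_eq_lineMap_of_mem_segment hpq hp.1 hq.1
  obtain ⟨z, t, rfl, rfl⟩ := exists_eq_lineMap_of_mem_segment hpq hp.2 hq.2
  have hinj := AffineMap.lineMap_injective ℝ hpq
  simp only [← image_segment, segment_eq_uIcc] at hp hq ⊢
  have key : ∀ r s : ℝ, p ∈ AffineMap.lineMap p q '' uIcc r s → (0 : ℝ) ∈ uIcc r s := by
    rintro r s ⟨o, ho, hop⟩
    rwa [show (0 : ℝ) = o from hinj (by rw [hop, AffineMap.lineMap_apply_zero])]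
  have h1 := key _ _ hp.1
  have h2 := key _ _ hp.2
  refine ⟨AffineMap.lineMap p q (min (min x y) (min z t)),
    AffineMap.lineMap p q (max (max x y) (max z t)), ?_⟩
  rw [← image_segment, segment_eq_uIcc, ← image_union,
    uIcc_of_le ((min_le_left _ _).trans (min_le_max.trans (le_max_left _ _)))]
  congr 1
  exact (Icc_union_Icc' (h2.1.trans h1.2) (h1.1.trans h2.2)).symm

/-- A maximal segment of a finite union of segments absorbs every segment of that union. -/
theorem exists_segment_subset_of_maximal {E ι : Type*} [AddCommGroup E] [Module ℝ E] [Finite ι]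
    {F : Set E} {v w : ι → E} (hF : F = ⋃ i, segment ℝ (v i) (w i))
    (hmax : ∀ i, ∀ a b : E, segment ℝ (v i) (w i) ⊆ segment ℝ a b →
      segment ℝ a b ⊆ F → segment ℝ a b = segment ℝ (v i) (w i))
    {a b : E} (hab : a ≠ b) (hF' : segment ℝ a b ⊆ F) :
    ∃ i, segment ℝ a b ⊆ segment ℝ (v i) (w i) := by
  have hinf : (segment ℝ a b).Infinite := by
    rw [segment_eq_image_lineMap]
    exact (Icc_infinite zero_lt_one).image (AffineMap.lineMap_injective ℝ hab).injOn
  have hcov : segment ℝ a b = ⋃ i, segment ℝ a b ∩ segment ℝ (v i) (w i) := by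
    rw [← inter_iUnion, ← hF, inter_eq_left.2 hF']
  obtain ⟨i, hi⟩ : ∃ i, (segment ℝ a b ∩ segment ℝ (v i) (w i)).Infinite := by
    by_contra! h
    refine hinf ?_
    rw [hcov]
    exact finite_iUnion h
  obtain ⟨p, hp, q, hq, hpq⟩ := hi.nontrivial
  obtain ⟨c, d, hcd⟩ := exists_segment_eq_union hpq hp hq
  refine ⟨i, ?_⟩
  rw [← hmax i c d (hcd ▸ subset_union_right)
    (hcd ▸ union_subset hF' (hF ▸ subset_iUnion (fun i => segment ℝ (v i) (w i)) i)), hcd]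
  exact subset_union_left

theorem dist_le_of_segment_subset {a b v w : Plane} (h : segment ℝ a b ⊆ segment ℝ v w) :
    dist a b ≤ dist v w := by
  rw [← Metric.diam_pair (x := v), ← convexHull_diam, convexHull_pair]
  refine Metric.dist_le_diam_of_mem ?_ (h (left_mem_segment ℝ a b)) (h (right_mem_segment ℝ a b))
  rw [← convexHull_pair]
  exact (isBounded_convexHull).2 (by simp)

/-- Every vertical line meeting a compact plane set meets its frontier. -/
theorem exists_mem_frontier_apply_zero_eq {Q : Set Plane} (hQ : IsCompact Q) {z : Plane}
    (hz : z ∈ Q) : ∃ x ∈ frontier Q, x 0 = z 0 := by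
  have hK : IsCompact (Q ∩ {x : Plane | x 0 = z 0}) :=
    hQ.inter_right (isClosed_eq (by fun_prop) continuous_const)
  obtain ⟨x, ⟨hxQ, hx0⟩, hmax⟩ := hK.exists_isMaxOn ⟨z, hz, rfl⟩
    (f := fun x : Plane => x 1) (by fun_prop)
  refine ⟨x, ⟨subset_closure hxQ, fun hint => ?_⟩, hx0⟩
  have hc : Filter.Tendsto (fun t : ℝ => x + t • EuclideanSpace.single (1 : Fin 2) (1 : ℝ))
      (nhdsWithin 0 (Ioi 0)) (nhds x) := by
    have : Continuous fun t : ℝ => x + t • EuclideanSpace.single (1 : Fin 2) (1 : ℝ) := by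
      fun_prop
    simpa using (this.tendsto 0).mono_left nhdsWithin_le_nhds
  obtain ⟨t, htQ, ht⟩ := ((hc.eventually (mem_interior_iff_mem_nhds.1 hint)).and
    self_mem_nhdsWithin).exists
  have := hmax (show x + t • EuclideanSpace.single (1 : Fin 2) (1 : ℝ) ∈
    Q ∩ {x : Plane | x 0 = z 0} from ⟨htQ, by simpa using hx0⟩)
  simp at this
  exact (not_le.2 ht) this

/-- If the frontier of a compact plane set containing a disc of radius `r` is covered by `m`
segments, then one of the segments is long. -/
theorem exists_two_mul_le_mul_dist {Q : Set Plane} (hQ : IsCompact Q) {x : Plane} {r : ℝ}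
    (hr : 0 < r) (hball : closedBall x r ⊆ Q) {m : ℕ} {v w : Fin m → Plane}
    (hf : frontier Q ⊆ ⋃ i, segment ℝ (v i) (w i)) :
    ∃ i, 2 * r ≤ m * dist (v i) (w i) := by
  have hcov : Icc (x 0 - r) (x 0 + r) ⊆ ⋃ i, uIcc (v i 0) (w i 0) := by
    intro t ht
    have hz : x + EuclideanSpace.single (0 : Fin 2) (t - x 0) ∈ Q := by
      refine hball ?_
      rw [mem_closedBall, dist_eq_norm, add_sub_cancel_left, PiLp.norm_single,
        Real.norm_eq_abs, abs_le]
      constructor <;> linarith [ht.1, ht.2]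
    obtain ⟨y, hy, hy0⟩ := exists_mem_frontier_apply_zero_eq hQ hz
    obtain ⟨i, hi⟩ := mem_iUnion.1 (hf hy)
    refine mem_iUnion.2 ⟨i, ?_⟩
    rw [← segment_eq_uIcc]
    have := mem_image_of_mem (EuclideanSpace.projₗ (𝕜 := ℝ) (0 : Fin 2)).toAffineMap hi
    rw [image_segment] at this
    simpa [hy0] using this
  have hle : ∀ i, |w i 0 - v i 0| ≤ dist (v i) (w i) := by
    intro i
    rw [dist_comm, dist_eq_norm]
    exact PiLp.norm_apply_le (w i - v i) 0
  have hsum : 2 * r ≤ ∑ i, dist (v i) (w i) := by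
    have h := (measure_mono hcov).trans (measure_iUnion_fintype_le volume _)
    simp only [Real.volume_Icc, Real.volume_interval] at h
    rw [← ENNReal.ofReal_sum_of_nonneg fun i _ => abs_nonneg _,
      ENNReal.ofReal_le_ofReal_iff (Finset.sum_nonneg fun i _ => abs_nonneg _)] at h
    linarith [Finset.sum_le_sum fun i (_ : i ∈ Finset.univ) => hle i]
  by_contra! h
  rcases Nat.eq_zero_or_pos m with rfl | hm
  · simp at hsum; linarith
  have hm' : (0 : ℝ) < m := by exact_mod_cast hm
  have : Nonempty (Fin m) := ⟨⟨0, hm⟩⟩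
  have hlt := Finset.sum_lt_sum_of_nonempty (s := Finset.univ) Finset.univ_nonempty
    fun i _ => h i
  rw [← Finset.mul_sum] at hlt
  simp at hlt
  nlinarith

theorem frontier_subset_frontier_diff_interior {X : Type*} [TopologicalSpace X] {s t : Set X}
    (hs : IsClosed s) (hts : t ⊆ s) : frontier s ⊆ frontier (s \ interior t) := by
  intro x hx
  refine ⟨subset_closure ⟨hs.frontier_subset hx, fun h => hx.2 (interior_mono hts h)⟩,
    fun h => hx.2 (interior_mono sdiff_subset h)⟩

theorem IsRing.isBounded {N₀ : ℕ} {c₀ β : ℝ} {R : Set Plane} (hR : IsRing N₀ c₀ β R) :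
    Bornology.IsBounded R := by
  obtain ⟨⟨Q₁, Q₂, hQ₁, -, rfl⟩, -⟩ := hR
  exact hQ₁.1.isBounded.subset sdiff_subset

theorem volume_toReal_le_pi_mul_diam_sq {R : Set Plane} (hR : Bornology.IsBounded R) :
    (volume R).toReal ≤ Real.pi * Metric.diam R ^ 2 := by
  rcases R.eq_empty_or_nonempty with rfl | ⟨x, hx⟩
  · simp
  have hsub : R ⊆ closedBall x (Metric.diam R) := fun y hy =>
    Metric.dist_le_diam_of_mem hR hy hx
  have h := measure_mono (μ := volume) hsub
  rw [EuclideanSpace.volume_closedBall_fin_two] at h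
  have h2 := ENNReal.toReal_mono (by finiteness) h
  refine h2.trans (le_of_eq ?_)
  simp [Metric.diam_nonneg, mul_comm, Real.pi_pos.le]

theorem IsRing.diam_sq_le_volume {N₀ : ℕ} {c₀ β : ℝ} (hc₀ : 1 ≤ c₀) (hβ : 0 ≤ β)
    (hβ' : β ≤ Real.pi) {R : Set Plane} (hR : IsRing N₀ c₀ β R) :
    Real.sin β / (32 * c₀ ^ 2 * (N₀ + 1) ^ 2) * Metric.diam R ^ 2 ≤ (volume R).toReal := by
  have hbdd := hR.isBounded
  have hsin : 0 ≤ Real.sin β := Real.sin_nonneg_of_nonneg_of_le_pi hβ hβ'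
  obtain ⟨⟨Q₁, Q₂, ⟨hcomp, -, -, ⟨m, v, w, hm, hf⟩, x₁, x₂, r₁, r₂, hr₂, hin, hout, hr⟩,
    hQ₂, hRQ⟩, n, v', w', hfR, hmax, htri⟩ := hR
  have hts : Q₂ ⊆ Q₁ := by
    rcases hQ₂ with rfl | h
    · exact empty_subset _
    · exact h.1
  obtain ⟨i, hi⟩ := exists_two_mul_le_mul_dist hcomp hr₂ hin hf.subset
  have hne : v i ≠ w i := by
    intro h
    rw [h, dist_self] at hi
    linarith
  have hseg : segment ℝ (v i) (w i) ⊆ frontier R := by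
    rw [hRQ]
    refine Subset.trans ?_ (frontier_subset_frontier_diff_interior hcomp.isClosed hts)
    rw [hf]
    exact subset_iUnion (fun i => segment ℝ (v i) (w i)) i
  obtain ⟨j, hj⟩ := exists_segment_subset_of_maximal hfR hmax hne hseg
  have hlen := dist_le_of_segment_subset hj
  obtain ⟨p, -, h1, h2⟩ := htri j
  have h1 := h1.dist_sq_le_volume hbdd
  have h2 := h2.dist_sq_le_volume hbdd
  set L := dist (v i) (w i)
  have htriangle := dist_triangle (v' j) p (w' j)
  have hL : Real.sin β / 32 * L ^ 2 ≤ (volume R).toReal := by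
    have hsq : L ^ 2 ≤ 2 * (dist (v' j) p ^ 2 + dist p (w' j) ^ 2) :=
      (pow_le_pow_left₀ dist_nonneg (hlen.trans htriangle) 2).trans add_sq_le
    have := mul_le_mul_of_nonneg_left hsq hsin
    linarith
  have hdiam : Metric.diam R ≤ c₀ * ((N₀ + 1) * L) := by
    have hr₁ : 0 ≤ r₁ := Metric.nonempty_closedBall.1
      ⟨x₂, hout (hin (mem_closedBall_self hr₂.le))⟩
    have hd : Metric.diam R ≤ 2 * r₁ :=
      Metric.diam_le_of_subset_closedBall hr₁ (hRQ ▸ sdiff_subset.trans hout)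
    have hmN : (m : ℝ) * L ≤ (N₀ + 1) * L := by
      have : (m : ℝ) ≤ N₀ := by exact_mod_cast hm
      exact mul_le_mul_of_nonneg_right (by linarith) dist_nonneg
    nlinarith
  refine le_trans ?_ hL
  have hsq := pow_le_pow_left₀ Metric.diam_nonneg hdiam 2
  calc _ ≤ Real.sin β / (32 * c₀ ^ 2 * (N₀ + 1) ^ 2) * (c₀ * ((N₀ + 1) * L)) ^ 2 := by
        gcongr
    _ = Real.sin β / 32 * L ^ 2 := by
        field_simp

/-- **For every ring `R`, `|R| ∼ d(R)²` with constants depending only on the structural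
parameters.** -/
theorem ring_measure_diam_equiv (N₀ : ℕ) (c₀ β : ℝ) (hc₀ : 1 ≤ c₀) (hβ : 0 < β) (hβ' : β ≤ Real.pi / 3) :
    ∃ c₁ c₂ : ℝ, 0 < c₁ ∧ 0 < c₂ ∧
      ∀ R : Set Plane, IsRing N₀ c₀ β R →
        c₁ * Metric.diam R ^ 2 ≤ (volume R).toReal ∧
          (volume R).toReal ≤ c₂ * Metric.diam R ^ 2 := by
  have hsin : 0 < Real.sin β :=
    Real.sin_pos_of_pos_of_lt_pi hβ (by linarith [Real.pi_pos])
  refine ⟨Real.sin β / (32 * c₀ ^ 2 * (N₀ + 1) ^ 2), Real.pi, by positivity, Real.pi_pos, ?_⟩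
  intro R hR
  exact ⟨hR.diam_sq_le_volume hc₀ hβ.le (by linarith [Real.pi_pos]),
    volume_toReal_le_pi_mul_diam_sq hR.isBounded⟩

end
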